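/- Fix integers n ≥ 1 and k ≥ 0, and let g₁ = R(π/n, π/n). Let V_k be the real vector space of functions f : ℝ⁴ → ℝ that are evaluations of homogeneous harmonic polynomials of degree k and satisfy f ∘ g₁ = f and f ∘ A = f. If k is odd then dim V_k = 0. If k = 2κ is even, then dim V_k = (2κ+1)·(⌊κ/n⌋ + 1) if κ is even, and dim V_k = (2κ+1)·⌊κ/n⌋ if κ is odd, where ⌊κ/n⌋ denotes the integer part of κ/n. -/

import Mathlib

noncomputable section


/-- `circ j u v` is `A_j(u,v)`: the real part of `(u + iv)^|j|` if `j ≥ 0`,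
and the imaginary part if `j < 0`. -/
def circ (j : ℤ) (u v : ℝ) : ℝ :=
  if 0 ≤ j then (((u : ℂ) + v * Complex.I) ^ j.natAbs).re
  else (((u : ℂ) + v * Complex.I) ^ j.natAbs).im

/-- `dd k ℓ m = (k - |ℓ| - |m|) / 2`. -/
def dd (k : ℕ) (ℓ m : ℤ) : ℕ := (k - ℓ.natAbs - m.natAbs) / 2

/-- The function `F_{kℓm} : ℝ⁴ → ℝ`. -/
def F (k : ℕ) (ℓ m : ℤ) (p : Fin 4 → ℝ) : ℝ :=
  (∑ i ∈ Finset.range (dd k ℓ m + 1),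
      (Nat.choose (m.natAbs + dd k ℓ m) i : ℝ) *
      (Nat.choose (ℓ.natAbs + dd k ℓ m) (dd k ℓ m - i) : ℝ) *
      (p 0 ^ 2 + p 1 ^ 2) ^ i * (-(p 2 ^ 2 + p 3 ^ 2)) ^ (dd k ℓ m - i))
    * circ ℓ (p 0) (p 1) * circ m (p 2) (p 3)

/-- `f` is the evaluation of a homogeneous polynomial of degree `k`. -/
def IsHomogeneousPolyEval (k : ℕ) (f : (Fin 4 → ℝ) → ℝ) : Prop :=
  ∃ P : MvPolynomial (Fin 4) ℝ, P.IsHomogeneous k ∧ ∀ v, MvPolynomial.eval v P = f v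

/-- `f` is harmonic: the sum of its four second coordinate partial derivatives vanishes. -/
def IsHarmonic (f : (Fin 4 → ℝ) → ℝ) : Prop :=
  ∀ v : Fin 4 → ℝ,
    ∑ i : Fin 4, fderiv ℝ (fun w => fderiv ℝ f w (Pi.single i 1)) v (Pi.single i 1) = 0

/-- The Jacobi polynomial `P_d^{(a,b)}`. -/
def jacobiP (d a b : ℕ) (u : ℝ) : ℝ :=
  (1 / 2 ^ d) * ∑ i ∈ Finset.range (d + 1),
    (Nat.choose (a + d) i : ℝ) * (Nat.choose (b + d) (d - i) : ℝ) *
      (u + 1) ^ i * (u - 1) ^ (d - i)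

/-- The radial function `X_{kℓm}`. -/
def Xrad (k : ℕ) (ℓ m : ℤ) (χ : ℝ) : ℝ :=
  Real.cos χ ^ ℓ.natAbs * Real.sin χ ^ m.natAbs *
    jacobiP (dd k ℓ m) m.natAbs ℓ.natAbs (Real.cos (2 * χ))

/-- The circular harmonic: `cos(|j|·θ)` if `j ≥ 0`, else `sin(|j|·θ)`. -/
def circHarm (j : ℤ) (θ : ℝ) : ℝ :=
  if 0 ≤ j then Real.cos (j.natAbs * θ) else Real.sin (j.natAbs * θ)

/-- The eigenmode `Ψ̃_{kℓm}` in toroidal coordinates. -/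
def PsiT (k : ℕ) (ℓ m : ℤ) (χ θ φ : ℝ) : ℝ :=
  Xrad k ℓ m χ * circHarm ℓ θ * circHarm m φ

/-- The rotation `R(Δθ, Δφ)` of `ℝ⁴`. -/
def Rrot (a b : ℝ) (p : Fin 4 → ℝ) : Fin 4 → ℝ :=
  ![p 0 * Real.cos a - p 1 * Real.sin a,
    p 0 * Real.sin a + p 1 * Real.cos a,
    p 2 * Real.cos b - p 3 * Real.sin b,
    p 2 * Real.sin b + p 3 * Real.cos b]

/-- The isometry `A(x,y,z,w) = (z, -w, -x, y)`. -/
def Amap (p : Fin 4 → ℝ) : Fin 4 → ℝ :=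
  ![p 2, -(p 3), -(p 0), p 1]

/-- The sign `σ_{kℓm}`. -/
def sgn (k : ℕ) (ℓ m : ℤ) : ℝ :=
  (if Even (dd k ℓ m) then 1 else -1) * (if 0 ≤ ℓ then 1 else -1) *
  (if 0 ≤ m then 1 else -1) * (if Even m then 1 else -1)

open MvPolynomial

/-- The complex coordinates `(x + iy, x - iy, z + iw, z - iw)` on `ℝ⁴`. -/
def complexCoord (v : Fin 4 → ℝ) : Fin 4 → ℂ :=
  ![v 0 + v 1 * Complex.I, v 0 - v 1 * Complex.I, v 2 + v 3 * Complex.I, v 2 - v 3 * Complex.I]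

/-- Rewrite a polynomial in the complex coordinates in terms of the real coordinates. -/
def toRealCoord : MvPolynomial (Fin 4) ℂ →ₐ[ℂ] MvPolynomial (Fin 4) ℂ :=
  aeval ![X 0 + C Complex.I * X 1, X 0 - C Complex.I * X 1,
    X 2 + C Complex.I * X 3, X 2 - C Complex.I * X 3]

/-- Rewrite a polynomial in the real coordinates in terms of the complex coordinates. -/
def toComplexCoord : MvPolynomial (Fin 4) ℂ →ₐ[ℂ] MvPolynomial (Fin 4) ℂ :=
  aeval ![C (1 / 2) * (X 0 + X 1), C (-Complex.I / 2) * (X 0 - X 1),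
    C (1 / 2) * (X 2 + X 3), C (-Complex.I / 2) * (X 2 - X 3)]

lemma eval_aeval_eq {σ τ : Type*} (g : σ → MvPolynomial τ ℂ) (x : τ → ℂ)
    (Q : MvPolynomial σ ℂ) : eval x (aeval g Q) = eval (fun i => eval x (g i)) Q := by
  induction Q using MvPolynomial.induction_on with
  | C a => simp
  | add p q hp hq => rw [map_add, map_add, map_add, hp, hq]
  | mul_X p i hp => rw [map_mul, map_mul, map_mul, hp, aeval_X, eval_X]

lemma eval_toRealCoord (v : Fin 4 → ℝ) (Q : MvPolynomial (Fin 4) ℂ) :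
    eval (fun i => (v i : ℂ)) (toRealCoord Q) = eval (complexCoord v) Q := by
  rw [toRealCoord, eval_aeval_eq]
  congr 2
  funext i
  fin_cases i <;> simp [complexCoord] <;> ring

lemma eval_toComplexCoord (v : Fin 4 → ℝ) (Q : MvPolynomial (Fin 4) ℂ) :
    eval (complexCoord v) (toComplexCoord Q) = eval (fun i => (v i : ℂ)) Q := by
  rw [toComplexCoord, eval_aeval_eq]
  congr 2
  funext i
  fin_cases i <;> simp [complexCoord] <;> ring_nf <;> simp

lemma toComplexCoord_toRealCoord (Q : MvPolynomial (Fin 4) ℂ) :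
    toComplexCoord (toRealCoord Q) = Q := by
  rw [← AlgHom.comp_apply]
  conv_rhs => rw [← AlgHom.id_apply (R := ℂ) Q]
  congr 1
  ext i : 1
  have hI : (C Complex.I * C Complex.I : MvPolynomial (Fin 4) ℂ) = -1 := by
    rw [← C_mul, Complex.I_mul_I]; simp
  have h2 : (C (1 / 2) : MvPolynomial (Fin 4) ℂ) * 2 = 1 := by
    rw [← map_ofNat C 2, ← C_mul]; simp
  have h3 : (C (-Complex.I / 2) : MvPolynomial (Fin 4) ℂ) = - (C Complex.I * C (1 / 2)) := by
    rw [← C_mul, ← C_neg]; ring_nf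
  fin_cases i <;> simp [toComplexCoord, toRealCoord, h3, -one_div]
  · linear_combination (-(X 0 - X 1) * C (1 / 2)) * hI + X 0 * h2
  · linear_combination ((X 0 - X 1) * C (1 / 2)) * hI + X 1 * h2
  · linear_combination (-(X 2 - X 3) * C (1 / 2)) * hI + X 2 * h2
  · linear_combination ((X 2 - X 3) * C (1 / 2)) * hI + X 3 * h2

lemma eq_of_forall_eval_ofReal {P Q : MvPolynomial (Fin 4) ℂ}
    (h : ∀ v : Fin 4 → ℝ, eval (fun i => (v i : ℂ)) P = eval (fun i => (v i : ℂ)) Q) :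
    P = Q := by
  refine funext_set (fun _ => Set.range Complex.ofReal)
    (fun _ => Set.infinite_range_of_injective Complex.ofReal_injective) fun x hx => ?_
  choose v hv using fun i => hx i (Set.mem_univ i)
  simpa [hv] using h v

lemma eq_of_forall_eval_complexCoord {P Q : MvPolynomial (Fin 4) ℂ}
    (h : ∀ v, eval (complexCoord v) P = eval (complexCoord v) Q) : P = Q := by
  rw [← toComplexCoord_toRealCoord P, ← toComplexCoord_toRealCoord Q]
  congr 1
  exact eq_of_forall_eval_ofReal fun v => by rw [eval_toRealCoord, eval_toRealCoord, h]

lemma isHomogeneous_toRealCoord {k : ℕ} {Q : MvPolynomial (Fin 4) ℂ} (hQ : Q.IsHomogeneous k) :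
    (toRealCoord Q).IsHomogeneous k := by
  have h : ∀ i, (C Complex.I * X i : MvPolynomial (Fin 4) ℂ).IsHomogeneous 1 := fun i => by
    simpa using (isHomogeneous_C _ _).mul (isHomogeneous_X _ i)
  rw [← one_mul k]
  refine hQ.aeval _ fun i => ?_
  fin_cases i
  · exact (isHomogeneous_X _ _).add (h _)
  · exact (isHomogeneous_X _ _).sub (h _)
  · exact (isHomogeneous_X _ _).add (h _)
  · exact (isHomogeneous_X _ _).sub (h _)

lemma isHomogeneous_toComplexCoord {k : ℕ} {Q : MvPolynomial (Fin 4) ℂ}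
    (hQ : Q.IsHomogeneous k) : (toComplexCoord Q).IsHomogeneous k := by
  have h : ∀ (a : ℂ) {R : MvPolynomial (Fin 4) ℂ}, R.IsHomogeneous 1 →
      (C a * R).IsHomogeneous 1 := fun a R hR => by
    simpa using (isHomogeneous_C _ a).mul hR
  rw [← one_mul k]
  refine hQ.aeval _ fun i => ?_
  fin_cases i
  · exact h _ ((isHomogeneous_X _ _).add (isHomogeneous_X _ _))
  · exact h _ ((isHomogeneous_X _ _).sub (isHomogeneous_X _ _))
  · exact h _ ((isHomogeneous_X _ _).add (isHomogeneous_X _ _))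
  · exact h _ ((isHomogeneous_X _ _).sub (isHomogeneous_X _ _))

lemma eval_ofReal_map (v : Fin 4 → ℝ) (P : MvPolynomial (Fin 4) ℝ) :
    eval (fun i => (v i : ℂ)) (map Complex.ofRealHom P) = ((eval v P : ℝ) : ℂ) := by
  rw [eval_map]
  exact (eval₂_comp_left Complex.ofRealHom (RingHom.id ℝ) v P).symm

/-- The Laplacian, up to the factor `4`, in the complex coordinates. -/
def complexLaplacian (Q : MvPolynomial (Fin 4) ℂ) : MvPolynomial (Fin 4) ℂ :=
  pderiv 0 (pderiv 1 Q) + pderiv 2 (pderiv 3 Q)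

lemma pderiv_toComplexCoord (Q : MvPolynomial (Fin 4) ℂ) :
    pderiv 0 (toComplexCoord Q) = C (1 / 2) * toComplexCoord (pderiv 0 Q) +
        C (-Complex.I / 2) * toComplexCoord (pderiv 1 Q) ∧
    pderiv 1 (toComplexCoord Q) = C (1 / 2) * toComplexCoord (pderiv 0 Q) -
        C (-Complex.I / 2) * toComplexCoord (pderiv 1 Q) ∧
    pderiv 2 (toComplexCoord Q) = C (1 / 2) * toComplexCoord (pderiv 2 Q) +
        C (-Complex.I / 2) * toComplexCoord (pderiv 3 Q) ∧
    pderiv 3 (toComplexCoord Q) = C (1 / 2) * toComplexCoord (pderiv 2 Q) -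
        C (-Complex.I / 2) * toComplexCoord (pderiv 3 Q) := by
  induction Q using MvPolynomial.induction_on with
  | C a => simp [toComplexCoord, algebraMap_eq]
  | add p q hp hq =>
    obtain ⟨hp0, hp1, hp2, hp3⟩ := hp
    obtain ⟨hq0, hq1, hq2, hq3⟩ := hq
    simp only [map_add, hp0, hp1, hp2, hp3, hq0, hq1, hq2, hq3]
    refine ⟨?_, ?_, ?_, ?_⟩ <;> ring
  | mul_X p i hp =>
    obtain ⟨hp0, hp1, hp2, hp3⟩ := hp
    simp only [map_mul, pderiv_mul, hp0, hp1, hp2, hp3, map_add, pderiv_X]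
    fin_cases i <;> simp [toComplexCoord, pderiv_X, -one_div] <;>
      (refine ⟨?_, ?_, ?_, ?_⟩ <;> ring)

lemma four_mul_complexLaplacian (Q : MvPolynomial (Fin 4) ℂ) :
    4 * complexLaplacian (toComplexCoord Q) =
      toComplexCoord (∑ i, pderiv i (pderiv i Q)) := by
  have hI : (C (-Complex.I / 2) * C (-Complex.I / 2) * 4 : MvPolynomial (Fin 4) ℂ) = -1 := by
    rw [← map_ofNat C 4, ← C_mul, ← C_mul]; ring_nf; simp
  have h2 : (C (1 / 2) * C (1 / 2) * 4 : MvPolynomial (Fin 4) ℂ) = 1 := by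
    rw [← map_ofNat C 4, ← C_mul, ← C_mul]; ring_nf; simp
  rw [complexLaplacian, (pderiv_toComplexCoord Q).2.1, (pderiv_toComplexCoord Q).2.2.2]
  have hc (i j : Fin 4) : pderiv i (pderiv j Q) = pderiv j (pderiv i Q) := by
    ext m
    simp only [coeff_pderiv, add_right_comm m (Finsupp.single i 1)]
    rcases eq_or_ne i j with rfl | hij
    · rfl
    · simp [hij, hij.symm]; ring
  simp only [map_sub, pderiv_C_mul, (pderiv_toComplexCoord _).1,
    (pderiv_toComplexCoord _).2.2.1, Fin.sum_univ_four, map_add, hc 1 0, hc 3 2]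
  linear_combination (toComplexCoord (pderiv 0 (pderiv 0 Q)) +
    toComplexCoord (pderiv 2 (pderiv 2 Q))) * h2 - (toComplexCoord (pderiv 1 (pderiv 1 Q)) +
    toComplexCoord (pderiv 3 (pderiv 3 Q))) * hI

lemma hasFDerivAt_eval (P : MvPolynomial (Fin 4) ℝ) (v : Fin 4 → ℝ) :
    HasFDerivAt (fun w => eval w P)
      (∑ i, eval v (pderiv i P) • ContinuousLinearMap.proj (R := ℝ) (φ := fun _ => ℝ) i) v := by
  induction P using MvPolynomial.induction_on with
  | C a => simpa using hasFDerivAt_const a v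
  | add p q hp hq =>
    simp only [map_add, add_smul, Finset.sum_add_distrib]
    exact hp.add hq
  | mul_X p i hp =>
    have := hp.mul (ContinuousLinearMap.proj (R := ℝ) (φ := fun _ : Fin 4 => ℝ) i).hasFDerivAt
    simp only [map_mul, eval_X]
    convert! this using 1
    ext w
    simp [pderiv_X, add_mul, Finset.sum_add_distrib, Pi.single_apply, Finset.mul_sum]
    simp [apply_ite (eval v), mul_left_comm, mul_comm]

lemma fderiv_eval_single (P : MvPolynomial (Fin 4) ℝ) (v : Fin 4 → ℝ) (i : Fin 4) :
    fderiv ℝ (fun w => eval w P) v (Pi.single i 1) = eval v (pderiv i P) := by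
  rw [(hasFDerivAt_eval P v).fderiv]
  simp [Pi.single_apply]

lemma isHarmonic_eval_iff (P : MvPolynomial (Fin 4) ℝ) :
    IsHarmonic (fun v => eval v P) ↔ ∑ i, pderiv i (pderiv i P) = 0 := by
  simp only [IsHarmonic, fderiv_eval_single]
  rw [MvPolynomial.funext_iff]
  simp

/-- Harmonicity of a real polynomial function, read off in the complex coordinates. -/
lemma isHarmonic_iff_complexLaplacian {f : (Fin 4 → ℝ) → ℝ} {P : MvPolynomial (Fin 4) ℝ}
    {Q : MvPolynomial (Fin 4) ℂ} (hP : ∀ v, eval v P = f v)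
    (hQ : ∀ v, eval (complexCoord v) Q = f v) : IsHarmonic f ↔ complexLaplacian Q = 0 := by
  obtain rfl : f = fun v => eval v P := funext fun v => (hP v).symm
  obtain rfl : Q = toComplexCoord (map Complex.ofRealHom P) :=
    eq_of_forall_eval_complexCoord fun v => by
      rw [hQ, eval_toComplexCoord, eval_ofReal_map]
  have h4 : (4 : MvPolynomial (Fin 4) ℂ) ≠ 0 := by
    rw [← map_ofNat C 4]; simp
  rw [isHarmonic_eval_iff, ← mul_right_inj' h4, mul_zero, four_mul_complexLaplacian]
  have hmap : ∑ i, pderiv i (pderiv i (map Complex.ofRealHom P)) =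
      map Complex.ofRealHom (∑ i, pderiv i (pderiv i P)) := by
    simp [pderiv_map]
  rw [hmap]
  constructor
  · intro h; simp [h]
  · intro h
    refine MvPolynomial.funext fun v => ?_
    have := congrArg (eval (complexCoord v)) h
    rw [eval_toComplexCoord, eval_ofReal_map, map_zero, Complex.ofReal_eq_zero] at this
    rw [this, map_zero]

/-- Real-valued polynomial functions in the complex coordinates are real polynomial functions. -/
lemma isHomogeneousPolyEval_of_complex {k : ℕ} {f : (Fin 4 → ℝ) → ℝ}
    {Q : MvPolynomial (Fin 4) ℂ} (hk : Q.IsHomogeneous k)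
    (hQ : ∀ v, eval (complexCoord v) Q = f v) : IsHomogeneousPolyEval k f := by
  refine ⟨∑ m ∈ (toRealCoord Q).support, monomial m (coeff m (toRealCoord Q)).re,
    IsHomogeneous.sum _ _ _ fun m hm => isHomogeneous_monomial _ ?_, fun v => ?_⟩
  · by_contra h
    exact mem_support_iff.mp hm ((isHomogeneous_toRealCoord hk).coeff_eq_zero h)
  · have h := congrArg Complex.re (hQ v)
    rw [← eval_toRealCoord, eval_eq', Complex.re_sum, Complex.ofReal_re] at h
    rw [← h, map_sum]
    refine Finset.sum_congr rfl fun m _ => ?_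
    rw [eval_monomial, Finsupp.prod_pow, ← Complex.re_mul_ofReal]
    simp

lemma exists_complex_of_isHomogeneousPolyEval {k : ℕ} {f : (Fin 4 → ℝ) → ℝ}
    (hf : IsHomogeneousPolyEval k f) :
    ∃ Q : MvPolynomial (Fin 4) ℂ, Q.IsHomogeneous k ∧ ∀ v, eval (complexCoord v) Q = f v := by
  obtain ⟨P, hk, hP⟩ := hf
  refine ⟨toComplexCoord (map Complex.ofRealHom P), isHomogeneous_toComplexCoord (hk.map _),
    fun v => ?_⟩
  rw [eval_toComplexCoord, eval_ofReal_map, hP]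

lemma coeff_aeval_smul_perm (u : Fin 4 → ℂ) (π : Equiv.Perm (Fin 4)) (Q : MvPolynomial (Fin 4) ℂ)
    (m : Fin 4 →₀ ℕ) :
    coeff (m.mapDomain π) (aeval (fun i => C (u i) * X (π i)) Q : MvPolynomial (Fin 4) ℂ) =
      (∏ i, u i ^ m i) * coeff m Q := by
  have h : ∀ (s : Fin 4 →₀ ℕ) (a : ℂ),
      (aeval (fun i => C (u i) * X (π i)) (monomial s a) : MvPolynomial (Fin 4) ℂ) =
        rename π (monomial s ((∏ i, u i ^ s i) * a)) := by
    intro s a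
    rw [aeval_monomial, monomial_eq, map_mul, rename_C, algebraMap_eq, Finsupp.prod_pow,
      Finsupp.prod_pow, map_prod, C_mul, map_prod]
    simp only [mul_pow, Finset.prod_mul_distrib, map_pow, rename_X]
    ring
  induction Q using MvPolynomial.induction_on' with
  | monomial s a =>
    rw [h, coeff_rename_mapDomain _ π.injective, coeff_monomial, coeff_monomial]
    split_ifs with hs
    · rw [hs]
    · simp
  | add p q hp hq => rw [map_add, coeff_add, hp, hq, coeff_add, mul_add]

lemma mapDomain_perm_surjective (π : Equiv.Perm (Fin 4)) :
    Function.Surjective (Finsupp.mapDomain π : (Fin 4 →₀ ℕ) → Fin 4 →₀ ℕ) := fun m =>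
  ⟨m.mapDomain π.symm, by rw [← Finsupp.mapDomain_comp]; simp⟩

/-- Invariance of a polynomial function under a monomial transformation of the complex
coordinates, read off from the coefficients. -/
lemma comp_eq_self_iff_coeff {f : (Fin 4 → ℝ) → ℝ} {Q : MvPolynomial (Fin 4) ℂ}
    (hQ : ∀ v, eval (complexCoord v) Q = f v) {T : (Fin 4 → ℝ) → Fin 4 → ℝ} {u : Fin 4 → ℂ}
    {π : Equiv.Perm (Fin 4)}
    (hT : ∀ v i, complexCoord (T v) i = u i * complexCoord v (π i)) :
    f ∘ T = f ↔ ∀ m, (∏ i, u i ^ m i) * coeff m Q = coeff (m.mapDomain π) Q := by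
  have h1 : f ∘ T = f ↔ (aeval (fun i => C (u i) * X (π i)) Q : MvPolynomial (Fin 4) ℂ) = Q := by
    have hev : ∀ v, eval (complexCoord v)
        (aeval (fun i => C (u i) * X (π i)) Q : MvPolynomial (Fin 4) ℂ) = f (T v) := fun v => by
      rw [eval_aeval_eq, ← hQ (T v)]
      congr 2
      funext i
      simp [hT]
    constructor
    · intro h
      refine eq_of_forall_eval_complexCoord fun v => ?_
      rw [hev, hQ, ← congrFun h v, Function.comp_apply]
    · intro h
      funext v
      have := hev v
      rw [h, hQ] at this
      exact_mod_cast this.symm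
  rw [h1, MvPolynomial.ext_iff, (mapDomain_perm_surjective π).forall]
  simp only [coeff_aeval_smul_perm]

/-- The permutation of the complex coordinates induced by complex conjugation. -/
def conjPerm : Equiv.Perm (Fin 4) := Equiv.swap 0 1 * Equiv.swap 2 3

lemma conj_complexCoord (v : Fin 4 → ℝ) (i : Fin 4) :
    (starRingEnd ℂ) (complexCoord v i) = complexCoord v (conjPerm i) := by
  fin_cases i <;> simp [complexCoord, conjPerm, Equiv.swap_apply_def, sub_eq_add_neg]

/-- Real-valuedness of a polynomial function in the complex coordinates, read off from the
coefficients. -/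
lemma forall_eval_real_iff_coeff (Q : MvPolynomial (Fin 4) ℂ) :
    (∀ v, eval (complexCoord v) Q = ((eval (complexCoord v) Q).re : ℂ)) ↔
      ∀ m, (starRingEnd ℂ) (coeff m Q) = coeff (m.mapDomain conjPerm) Q := by
  have hev : ∀ v, eval (complexCoord v) (rename conjPerm (map (starRingEnd ℂ) Q)) =
      (starRingEnd ℂ) (eval (complexCoord v) Q) := fun v => by
    rw [eval_rename, eval_map, ← eval₂_id, ← MvPolynomial.coe_eval₂Hom,
      ← MvPolynomial.coe_eval₂Hom, ← RingHom.comp_apply]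
    congr 1
    refine MvPolynomial.ringHom_ext (fun r => by simp) fun i => ?_
    simp [conj_complexCoord]
  have h1 : (∀ v, eval (complexCoord v) Q = ((eval (complexCoord v) Q).re : ℂ)) ↔
      rename conjPerm (map (starRingEnd ℂ) Q) = Q := by
    constructor
    · intro h
      refine eq_of_forall_eval_complexCoord fun v => ?_
      rw [hev, h v, Complex.conj_ofReal]
    · intro h v
      have := hev v
      rw [h] at this
      exact (Complex.conj_eq_iff_re.mp this.symm).symm
  rw [h1, MvPolynomial.ext_iff, (mapDomain_perm_surjective conjPerm).forall]
  simp only [coeff_rename_mapDomain _ conjPerm.injective, coeff_map]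

/-- The exponent vector `(i, j, k, l)`. -/
def expVec (i j k l : ℕ) : Fin 4 →₀ ℕ := Finsupp.equivFunOnFinite.symm ![i, j, k, l]

lemma expVec_self (m : Fin 4 →₀ ℕ) : expVec (m 0) (m 1) (m 2) (m 3) = m := by
  ext a; fin_cases a <;> rfl

lemma forall_expVec {p : (Fin 4 →₀ ℕ) → Prop} :
    (∀ m, p m) ↔ ∀ i j k l, p (expVec i j k l) :=
  ⟨fun h _ _ _ _ => h _, fun h m => by rw [← expVec_self m]; exact h _ _ _ _⟩

lemma degree_expVec (i j k l : ℕ) : (expVec i j k l).degree = i + j + k + l := by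
  simp [Finsupp.degree_eq_sum, Fin.sum_univ_four, expVec]

lemma mapDomain_conjPerm_expVec (i j k l : ℕ) :
    (expVec i j k l).mapDomain conjPerm = expVec j i l k := by
  ext a
  obtain ⟨b, rfl⟩ := conjPerm.surjective a
  rw [Finsupp.mapDomain_apply conjPerm.injective]
  fin_cases b <;> rfl

lemma mapDomain_revPerm_expVec (i j k l : ℕ) :
    (expVec i j k l).mapDomain Fin.revPerm = expVec l k j i := by
  ext a
  obtain ⟨b, rfl⟩ := (Fin.revPerm (n := 4)).surjective a
  rw [Finsupp.mapDomain_apply (Equiv.injective _)]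
  fin_cases b <;> rfl

lemma complexLaplacian_eq_zero_iff_coeff (Q : MvPolynomial (Fin 4) ℂ) :
    complexLaplacian Q = 0 ↔ ∀ i j k l : ℕ,
      (i + 1) * (j + 1) * coeff (expVec (i + 1) (j + 1) k l) Q +
        (k + 1) * (l + 1) * coeff (expVec i j (k + 1) (l + 1)) Q = 0 := by
  rw [MvPolynomial.ext_iff, forall_expVec]
  refine forall_congr' fun i => forall_congr' fun j => forall_congr' fun k =>
    forall_congr' fun l => ?_
  have h1 : expVec i j k l + Finsupp.single 0 1 + Finsupp.single 1 1 =
      expVec (i + 1) (j + 1) k l := by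
    ext a
    rw [Finsupp.add_apply, Finsupp.add_apply, Finsupp.single_apply, Finsupp.single_apply]
    fin_cases a <;> simp [expVec]
  have h2 : expVec i j k l + Finsupp.single 2 1 + Finsupp.single 3 1 =
      expVec i j (k + 1) (l + 1) := by
    ext a
    rw [Finsupp.add_apply, Finsupp.add_apply, Finsupp.single_apply, Finsupp.single_apply]
    fin_cases a <;> simp [expVec]
  simp only [complexLaplacian, coeff_add, coeff_pderiv, h1, h2, coeff_zero]
  simp [expVec]
  ring_nf

lemma comp_Rrot_eq_self_iff_coeff {f : (Fin 4 → ℝ) → ℝ} {Q : MvPolynomial (Fin 4) ℂ}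
    (hQ : ∀ v, eval (complexCoord v) Q = f v) {n : ℕ} (hn : 1 ≤ n) :
    f ∘ Rrot (Real.pi / n) (Real.pi / n) = f ↔ ∀ i j k l : ℕ,
      coeff (expVec i j k l) Q ≠ 0 → (2 * n : ℤ) ∣ i + k - j - l := by
  set e : ℂ := Real.pi / n * Complex.I with he
  have hT : ∀ v i, complexCoord (Rrot (Real.pi / n) (Real.pi / n) v) i =
      ![Complex.exp e, Complex.exp (-e), Complex.exp e, Complex.exp (-e)] i *
        complexCoord v ((1 : Equiv.Perm (Fin 4)) i) := by
    have h1 : Complex.exp e = Complex.cos (Real.pi / n) + Complex.sin (Real.pi / n) * Complex.I :=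
      Complex.exp_mul_I _
    have h2 : Complex.exp (-e) =
        Complex.cos (Real.pi / n) - Complex.sin (Real.pi / n) * Complex.I := by
      rw [he, ← neg_mul, Complex.exp_mul_I, Complex.cos_neg, Complex.sin_neg]; ring
    intro v i
    rw [h1, h2]
    fin_cases i <;> simp [complexCoord, Rrot] <;> ring_nf <;> simp <;> ring
  rw [comp_eq_self_iff_coeff hQ hT, forall_expVec]
  refine forall_congr' fun i => forall_congr' fun j => forall_congr' fun k =>
    forall_congr' fun l => ?_
  have hprod : (∏ a, (![Complex.exp e, Complex.exp (-e), Complex.exp e, Complex.exp (-e)] a) ^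
      (expVec i j k l) a) = Complex.exp (((i + k - j - l : ℤ) : ℂ) * e) := by
    simp only [Fin.prod_univ_four]
    simp [expVec, ← Complex.exp_nat_mul, ← Complex.exp_add]
    congr 1
    ring
  have hn0 : (n : ℂ) ≠ 0 := by exact_mod_cast (by omega : n ≠ 0)
  have hpi : (Real.pi : ℂ) ≠ 0 := by exact_mod_cast Real.pi_ne_zero
  have hone : Complex.exp (((i + k - j - l : ℤ) : ℂ) * e) = 1 ↔
      (2 * n : ℤ) ∣ i + k - j - l := by
    rw [Complex.exp_eq_one_iff]
    refine exists_congr fun c => ?_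
    rw [he, ← @Int.cast_inj ℂ, ← mul_left_inj' (mul_ne_zero hpi Complex.I_ne_zero),
      ← mul_left_inj' hn0]
    push_cast
    field_simp
  rw [hprod, Equiv.Perm.coe_one, Finsupp.mapDomain_id, ← hone]
  by_cases h0 : coeff (expVec i j k l) Q = 0
  · simp [h0]
  · simp [h0]

lemma comp_Amap_eq_self_iff_coeff {f : (Fin 4 → ℝ) → ℝ} {Q : MvPolynomial (Fin 4) ℂ}
    (hQ : ∀ v, eval (complexCoord v) Q = f v) :
    f ∘ Amap = f ↔ ∀ i j k l : ℕ,
      (-1) ^ (k + l) * coeff (expVec i j k l) Q = coeff (expVec l k j i) Q := by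
  have hT : ∀ v i, complexCoord (Amap v) i =
      ![1, 1, -1, -1] i * complexCoord v (Fin.revPerm i) := by
    intro v i
    fin_cases i <;> simp [complexCoord, Amap, Fin.rev] <;> ring
  rw [comp_eq_self_iff_coeff hQ hT, forall_expVec]
  refine forall_congr' fun i => forall_congr' fun j => forall_congr' fun k =>
    forall_congr' fun l => ?_
  rw [mapDomain_revPerm_expVec]
  simp [Fin.prod_univ_four, expVec, pow_add]

/-- The homogeneous polynomial of degree `K` whose coefficient at `(i, j, k, l)` is
`(-1) ^ i * γ (i + k) (i + l) / (i! j! k! l!)`. -/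
def harmonicPoly (K : ℕ) (γ : ℕ → ℕ → ℂ) : MvPolynomial (Fin 4) ℂ :=
  ∑ m ∈ Finset.univ.finsuppAntidiag K, monomial m
    ((-1) ^ m 0 * γ (m 0 + m 2) (m 0 + m 3) /
      ((m 0).factorial * (m 1).factorial * (m 2).factorial * (m 3).factorial))

lemma coeff_harmonicPoly (K : ℕ) (γ : ℕ → ℕ → ℂ) (i j k l : ℕ) :
    coeff (expVec i j k l) (harmonicPoly K γ) = if i + j + k + l = K then
      (-1) ^ i * γ (i + k) (i + l) /
        (i.factorial * j.factorial * k.factorial * l.factorial) else 0 := by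
  simp only [harmonicPoly, coeff_sum, coeff_monomial, Finset.sum_ite_eq',
    Finset.mem_finsuppAntidiag', Finset.subset_univ, and_true]
  simp [Finsupp.sum_fintype, Fin.sum_univ_four, expVec]

lemma harmonicPoly_isHomogeneous (K : ℕ) (γ : ℕ → ℕ → ℂ) :
    (harmonicPoly K γ).IsHomogeneous K := by
  refine IsHomogeneous.sum _ _ _ fun m hm => isHomogeneous_monomial _ ?_
  rw [Finsupp.degree_eq_sum]
  exact (Finset.mem_finsuppAntidiag.mp hm).1

lemma complexLaplacian_harmonicPoly (K : ℕ) (γ : ℕ → ℕ → ℂ) :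
    complexLaplacian (harmonicPoly K γ) = 0 := by
  rw [complexLaplacian_eq_zero_iff_coeff]
  intro i j k l
  have h0 : ∀ a : ℕ, (a.factorial : ℂ) ≠ 0 := fun a => by exact_mod_cast a.factorial_ne_zero
  have h1 : ∀ a : ℕ, (a + 1 : ℂ) ≠ 0 := fun a => by exact_mod_cast a.succ_ne_zero
  rw [coeff_harmonicPoly, coeff_harmonicPoly, show i + 1 + (j + 1) + k + l =
    i + j + (k + 1) + (l + 1) by ring, show i + 1 + k = i + (k + 1) by ring,
    show i + 1 + l = i + (l + 1) by ring]
  split_ifs with h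
  · simp only [Nat.factorial_succ, Nat.cast_mul, Nat.cast_add, Nat.cast_one]
    have := h0 i; have := h0 j; have := h0 k; have := h0 l
    have := h1 i; have := h1 j; have := h1 k; have := h1 l
    field_simp
    ring
  · simp

/-- Every harmonic homogeneous polynomial comes from a (unique) table `γ`. -/
lemma exists_eq_harmonicPoly {K : ℕ} {Q : MvPolynomial (Fin 4) ℂ} (hK : Q.IsHomogeneous K)
    (hQ : complexLaplacian Q = 0) : ∃ γ : ℕ → ℕ → ℂ,
      (∀ p t, ¬(p ≤ K ∧ t ≤ K) → γ p t = 0) ∧ Q = harmonicPoly K γ := by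
  rw [complexLaplacian_eq_zero_iff_coeff] at hQ
  set D : ℕ → ℕ → ℕ → ℕ → ℂ := fun i j k l => (-1) ^ i *
    (i.factorial * j.factorial * k.factorial * l.factorial) * coeff (expVec i j k l) Q with hD
  have hstep : ∀ i j k l, D (i + 1) (j + 1) k l = D i j (k + 1) (l + 1) := by
    intro i j k l
    simp only [hD, Nat.factorial_succ, Nat.cast_mul, Nat.cast_add, Nat.cast_one, pow_succ]
    linear_combination (-(-1) ^ i *
      (i.factorial * j.factorial * k.factorial * l.factorial)) * hQ i j k l
  have hsteps : ∀ r i j k l, D (i + r) (j + r) k l = D i j (k + r) (l + r) := by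
    intro r
    induction r with
    | zero => intros; rfl
    | succ r ih =>
      intro i j k l
      rw [← add_assoc, ← add_assoc, hstep, ih]
      congr 1 <;> ring
  refine ⟨fun p t => if p ≤ K ∧ t ≤ K then
    D (p + t - K) (K - p - t) (p - (p + t - K)) (t - (p + t - K)) else 0,
    fun p t h => if_neg h, ?_⟩
  rw [MvPolynomial.ext_iff, forall_expVec]
  intro i j k l
  rw [coeff_harmonicPoly]
  split_ifs with h hle
  · have : D (i + k + (i + l) - K) (K - (i + k) - (i + l)) (i + k - (i + k + (i + l) - K))
        (i + l - (i + k + (i + l) - K)) = D i j k l := by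
      rcases le_total i j with hij | hij
      · obtain ⟨r, rfl⟩ := Nat.exists_eq_add_of_le hij
        have := hsteps i 0 r k l
        rw [zero_add, add_comm r i] at this
        rw [this]
        congr 1 <;> omega
      · obtain ⟨r, rfl⟩ := Nat.exists_eq_add_of_le hij
        have := hsteps j r 0 k l
        rw [zero_add, add_comm r j] at this
        rw [this]
        congr 1 <;> omega
    rw [this, hD]
    have h0 : ∀ a : ℕ, (a.factorial : ℂ) ≠ 0 := fun a => by exact_mod_cast a.factorial_ne_zero
    have := h0 i; have := h0 j; have := h0 k; have := h0 l
    field_simp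
    rw [← pow_mul, mul_comm i 2, pow_mul]
    simp
  · omega
  · exact hK.coeff_eq_zero (by rwa [degree_expVec])

/-- The tables `γ` for which `harmonicPoly K γ` is a real function invariant under the binary
dihedral group. -/
def invariantTable (n K : ℕ) : Submodule ℝ (ℕ → ℕ → ℂ) where
  carrier := {γ | (∀ p t, ¬(p ≤ K ∧ t ≤ K) → γ p t = 0) ∧
    (∀ p t, γ p t ≠ 0 → (2 * n : ℤ) ∣ 2 * p - K) ∧
    (∀ p t, p ≤ K → t ≤ K → γ (K - p) t = (-1) ^ p * γ p t) ∧
    (∀ p t, p ≤ K → t ≤ K → γ p (K - t) = (-1) ^ (K + t) * (starRingEnd ℂ) (γ p t))}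
  zero_mem' := by simp
  add_mem' := by
    rintro a b ⟨a1, a2, a3, a4⟩ ⟨b1, b2, b3, b4⟩
    refine ⟨fun p t h => ?_, fun p t h => ?_, fun p t hp ht => ?_, fun p t hp ht => ?_⟩
    · simp [a1 p t h, b1 p t h]
    · by_contra hn
      exact h (by simp [not_not.mp (mt (a2 p t) hn), not_not.mp (mt (b2 p t) hn)])
    · simp [a3 p t hp ht, b3 p t hp ht, mul_add]
    · simp [a4 p t hp ht, b4 p t hp ht, mul_add]
  smul_mem' := by
    rintro c a ⟨a1, a2, a3, a4⟩
    refine ⟨fun p t h => ?_, fun p t h => ?_, fun p t hp ht => ?_, fun p t hp ht => ?_⟩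
    · simp [a1 p t h]
    · exact a2 p t fun h0 => h (by simp [h0])
    · simp [a3 p t hp ht, mul_left_comm]
    · simp [a4 p t hp ht, mul_left_comm]

lemma exists_exponents {K p t : ℕ} (hp : p ≤ K) (ht : t ≤ K) :
    ∃ i j k l : ℕ, i + j + k + l = K ∧ i + k = p ∧ i + l = t := by
  rcases le_total (p + t) K with h | h
  · exact ⟨0, K - p - t, p, t, by omega, by omega, by omega⟩
  · exact ⟨p + t - K, 0, K - t, K - p, by omega, by omega, by omega⟩

lemma harmonicPoly_injective {K : ℕ} {γ δ : ℕ → ℕ → ℂ}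
    (hγ : ∀ p t, ¬(p ≤ K ∧ t ≤ K) → γ p t = 0) (hδ : ∀ p t, ¬(p ≤ K ∧ t ≤ K) → δ p t = 0)
    (h : harmonicPoly K γ = harmonicPoly K δ) : γ = δ := by
  funext p t
  by_cases hpt : p ≤ K ∧ t ≤ K
  · obtain ⟨i, j, k, l, hK, rfl, rfl⟩ := exists_exponents hpt.1 hpt.2
    have := congrArg (coeff (expVec i j k l)) h
    rw [coeff_harmonicPoly, coeff_harmonicPoly, if_pos hK, if_pos hK] at this
    have h0 : ∀ a : ℕ, (a.factorial : ℂ) ≠ 0 := fun a => by exact_mod_cast a.factorial_ne_zero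
    have := h0 i; have := h0 j; have := h0 k; have := h0 l
    field_simp at *
    assumption
  · rw [hγ p t hpt, hδ p t hpt]

lemma comp_Rrot_harmonicPoly_iff {f : (Fin 4 → ℝ) → ℝ} {n K : ℕ} {γ : ℕ → ℕ → ℂ}
    (hγ : ∀ p t, ¬(p ≤ K ∧ t ≤ K) → γ p t = 0)
    (hf : ∀ v, eval (complexCoord v) (harmonicPoly K γ) = f v) (hn : 1 ≤ n) :
    f ∘ Rrot (Real.pi / n) (Real.pi / n) = f ↔
      ∀ p t, γ p t ≠ 0 → (2 * n : ℤ) ∣ 2 * p - K := by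
  rw [comp_Rrot_eq_self_iff_coeff hf hn]
  have key : ∀ i j k l : ℕ, i + j + k + l = K →
      ((i + k - j - l : ℤ) = 2 * (i + k : ℕ) - K) := fun i j k l h => by
    rw [← h]; push_cast; ring
  constructor
  · intro h p t hpt
    have hle : p ≤ K ∧ t ≤ K := by
      by_contra hle
      exact hpt (hγ p t hle)
    obtain ⟨i, j, k, l, hK, rfl, rfl⟩ := exists_exponents hle.1 hle.2
    rw [← key i j k l hK]
    refine h i j k l ?_
    rw [coeff_harmonicPoly, if_pos hK]
    simp [hpt, Nat.factorial_ne_zero]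
  · intro h i j k l hc
    rw [coeff_harmonicPoly] at hc
    split_ifs at hc with hK
    · rw [key i j k l hK]
      refine h _ (i + l) fun h0 => hc ?_
      rw [h0]; simp
    · exact absurd rfl hc

lemma comp_Amap_harmonicPoly_iff {f : (Fin 4 → ℝ) → ℝ} {K : ℕ} {γ : ℕ → ℕ → ℂ}
    (hf : ∀ v, eval (complexCoord v) (harmonicPoly K γ) = f v) :
    f ∘ Amap = f ↔
      ∀ p t, p ≤ K → t ≤ K → γ (K - p) t = (-1) ^ p * γ p t := by
  rw [comp_Amap_eq_self_iff_coeff hf]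
  have key : ∀ i j k l : ℕ, i + j + k + l = K →
      ((-1) ^ (k + l) * coeff (expVec i j k l) (harmonicPoly K γ) =
        coeff (expVec l k j i) (harmonicPoly K γ) ↔
      γ (K - (i + k)) (i + l) = (-1) ^ (i + k) * γ (i + k) (i + l)) := fun i j k l h => by
    rw [coeff_harmonicPoly, coeff_harmonicPoly, if_pos h, if_pos (by omega),
      show K - (i + k) = l + j by omega, add_comm l i]
    have h0 : ∀ a : ℕ, (a.factorial : ℂ) ≠ 0 := fun a => by exact_mod_cast a.factorial_ne_zero
    have := h0 i; have := h0 j; have := h0 k; have := h0 l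
    have hl : (-1 : ℂ) ^ l ≠ 0 := by simp
    field_simp
    have hll : (-1 : ℂ) ^ (l * 2) = 1 := by rw [mul_comm, pow_mul]; simp
    rw [pow_add, pow_add, ← mul_right_inj' hl, eq_comm]
    ring_nf
    simp only [hll, mul_one]
  constructor
  · intro h p t hp ht
    obtain ⟨i, j, k, l, hK, rfl, rfl⟩ := exists_exponents hp ht
    exact (key i j k l hK).mp (h i j k l)
  · intro h i j k l
    by_cases hK : i + j + k + l = K
    · exact (key i j k l hK).mpr (h _ _ (by omega) (by omega))
    · rw [coeff_harmonicPoly, coeff_harmonicPoly, if_neg hK, if_neg (by omega), mul_zero]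

lemma harmonicPoly_real_iff {K : ℕ} {γ : ℕ → ℕ → ℂ} :
    (∀ v, eval (complexCoord v) (harmonicPoly K γ) =
      ((eval (complexCoord v) (harmonicPoly K γ)).re : ℂ)) ↔
      ∀ p t, p ≤ K → t ≤ K →
        γ (K - p) (K - t) = (-1) ^ (K + p + t) * (starRingEnd ℂ) (γ p t) := by
  rw [forall_eval_real_iff_coeff, forall_expVec]
  simp only [mapDomain_conjPerm_expVec]
  have key : ∀ i j k l : ℕ, i + j + k + l = K →
      ((starRingEnd ℂ) (coeff (expVec i j k l) (harmonicPoly K γ)) =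
        coeff (expVec j i l k) (harmonicPoly K γ) ↔
      γ (K - (i + k)) (K - (i + l)) =
        (-1) ^ (K + (i + k) + (i + l)) * (starRingEnd ℂ) (γ (i + k) (i + l))) :=
      fun i j k l h => by
    rw [coeff_harmonicPoly, coeff_harmonicPoly, if_pos h, if_pos (by omega),
      show K - (i + k) = j + l by omega, show K - (i + l) = j + k by omega]
    have h0 : ∀ a : ℕ, (a.factorial : ℂ) ≠ 0 := fun a => by exact_mod_cast a.factorial_ne_zero
    have := h0 i; have := h0 j; have := h0 k; have := h0 l
    have hj : (-1 : ℂ) ^ j ≠ 0 := by simp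
    have hsign : (-1 : ℂ) ^ (K + (i + k) + (i + l)) = (-1) ^ j * (-1) ^ i := by
      rw [← h, show i + j + k + l + (i + k) + (i + l) = 2 * (i + k + l) + (j + i) by ring,
        pow_add, pow_mul]
      simp [pow_add]
    have hjj : (-1 : ℂ) ^ j * (-1) ^ j = 1 := by rw [← mul_pow]; simp
    rw [hsign]
    simp only [map_div₀, map_mul, map_pow, map_neg, map_one, map_natCast]
    field_simp
    constructor
    · intro h
      linear_combination (-(-1) ^ j) * h - γ (j + l) (j + k) * hjj
    · intro h
      linear_combination (-(-1) ^ j) * h -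
        (-1) ^ i * (starRingEnd ℂ) (γ (i + k) (i + l)) * hjj
  constructor
  · intro h p t hp ht
    obtain ⟨i, j, k, l, hK, rfl, rfl⟩ := exists_exponents hp ht
    exact (key i j k l hK).mp (h i j k l)
  · intro h i j k l
    by_cases hK : i + j + k + l = K
    · exact (key i j k l hK).mpr (h _ _ (by omega) (by omega))
    · rw [coeff_harmonicPoly, coeff_harmonicPoly, if_neg hK, if_neg (by omega), map_zero]

/-- The real function attached to a table `γ`. -/
def harmonicFun (K : ℕ) : (ℕ → ℕ → ℂ) →ₗ[ℝ] ((Fin 4 → ℝ) → ℝ) where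
  toFun γ v := (eval (complexCoord v) (harmonicPoly K γ)).re
  map_add' γ δ := by
    have : harmonicPoly K (γ + δ) = harmonicPoly K γ + harmonicPoly K δ := by
      simp [harmonicPoly, mul_add, add_div, Finset.sum_add_distrib]
    funext v
    simp [this]
  map_smul' c γ := by
    have : harmonicPoly K (c • γ) = C (c : ℂ) * harmonicPoly K γ := by
      simp only [harmonicPoly, Finset.mul_sum, C_mul_monomial]
      refine Finset.sum_congr rfl fun m _ => ?_
      congr 1
      simp
      ring
    funext v
    simp [this]

lemma eval_eq_harmonicFun {n K : ℕ} {γ : ℕ → ℕ → ℂ} (hγ : γ ∈ invariantTable n K)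
    (v : Fin 4 → ℝ) :
    eval (complexCoord v) (harmonicPoly K γ) = harmonicFun K γ v := by
  refine harmonicPoly_real_iff.mpr (fun p t hp ht => ?_) v
  rw [hγ.2.2.1 p _ hp (Nat.sub_le _ _), hγ.2.2.2 p t hp ht, ← mul_assoc, ← pow_add]
  congr 2
  ring

lemma setOf_invariant_harmonic_eq_range {n : ℕ} (hn : 1 ≤ n) (K : ℕ) :
    {f : (Fin 4 → ℝ) → ℝ | IsHomogeneousPolyEval K f ∧ IsHarmonic f ∧
      f ∘ Rrot (Real.pi / n) (Real.pi / n) = f ∧ f ∘ Amap = f} =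
    LinearMap.range ((harmonicFun K).domRestrict (invariantTable n K)) := by
  ext f
  constructor
  · rintro ⟨hpoly, hharm, hR, hA⟩
    obtain ⟨Q, hK, hQ⟩ := exists_complex_of_isHomogeneousPolyEval hpoly
    obtain ⟨P, -, hP⟩ := hpoly
    obtain ⟨γ, hγ, rfl⟩ :=
      exists_eq_harmonicPoly hK ((isHarmonic_iff_complexLaplacian hP hQ).mp hharm)
    rw [comp_Rrot_harmonicPoly_iff hγ hQ hn] at hR
    rw [comp_Amap_harmonicPoly_iff hQ] at hA
    have hreal := harmonicPoly_real_iff.mp fun v => by rw [hQ, Complex.ofReal_re]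
    refine ⟨⟨γ, hγ, hR, hA, fun p t hp ht => ?_⟩, ?_⟩
    · have h1 := hreal p t hp ht
      rw [hA p _ hp (Nat.sub_le _ _)] at h1
      have hpp : (-1 : ℂ) ^ p * (-1) ^ p = 1 := by rw [← mul_pow]; simp
      have h2 : (-1 : ℂ) ^ (K + p + t) = (-1) ^ p * (-1) ^ (K + t) := by ring
      rw [h2] at h1
      linear_combination (-1) ^ p * h1 +
        ((-1) ^ (K + t) * (starRingEnd ℂ) (γ p t) - γ p (K - t)) * hpp
    · funext v
      change (eval (complexCoord v) (harmonicPoly K γ)).re = f v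
      rw [hQ, Complex.ofReal_re]
  · rintro ⟨⟨γ, hγ⟩, rfl⟩
    have hev := eval_eq_harmonicFun hγ
    have hpoly := isHomogeneousPolyEval_of_complex (harmonicPoly_isHomogeneous K γ) hev
    obtain ⟨P, -, hP⟩ := id hpoly
    exact ⟨hpoly, (isHarmonic_iff_complexLaplacian hP hev).mpr
      (complexLaplacian_harmonicPoly K γ),
      (comp_Rrot_harmonicPoly_iff hγ.1 hev hn).mpr hγ.2.1,
      (comp_Amap_harmonicPoly_iff hev).mpr hγ.2.2.1⟩

lemma finrank_invariant_harmonic {n : ℕ} (hn : 1 ≤ n) (K : ℕ) :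
    Set.finrank ℝ {f : (Fin 4 → ℝ) → ℝ | IsHomogeneousPolyEval K f ∧ IsHarmonic f ∧
      f ∘ Rrot (Real.pi / n) (Real.pi / n) = f ∧ f ∘ Amap = f} =
    Module.finrank ℝ (invariantTable n K) := by
  rw [setOf_invariant_harmonic_eq_range hn, Set.finrank, Submodule.span_eq]
  refine LinearMap.finrank_range_of_inj ?_
  rintro ⟨γ, hγ⟩ ⟨δ, hδ⟩ h
  refine Subtype.ext (harmonicPoly_injective hγ.1 hδ.1
    (eq_of_forall_eval_complexCoord fun v => ?_))
  rw [eval_eq_harmonicFun hγ, eval_eq_harmonicFun hδ]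
  exact congrArg _ (congrFun h v)

lemma invariantTable_eq_bot_of_odd (n : ℕ) {K : ℕ} (hK : Odd K) : invariantTable n K = ⊥ := by
  rw [eq_bot_iff]
  rintro γ ⟨h1, -, h3, -⟩
  rw [Submodule.mem_bot]
  funext p t
  by_cases hpt : p ≤ K ∧ t ≤ K
  · have h := h3 (K - p) t (Nat.sub_le _ _) hpt.2
    rw [Nat.sub_sub_self hpt.1, h3 p t hpt.1 hpt.2, ← mul_assoc, ← pow_add,
      Nat.sub_add_cancel hpt.1, hK.neg_one_pow] at h
    have : (2 : ℂ) * γ p t = 0 := by linear_combination h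
    simpa using this
  · exact h1 p t hpt

/-- Positions `j` of the independent columns `κ + n * j` of a table in
`invariantTable n (2 * κ)`. -/
def freeColumns (n κ : ℕ) : Finset ℕ :=
  (Finset.range (κ / n + 1)).filter fun j => Even κ ∨ j ≠ 0

lemma card_freeColumns (n κ : ℕ) :
    (freeColumns n κ).card = if Even κ then κ / n + 1 else κ / n := by
  unfold freeColumns
  split_ifs with h
  · simp [h]
  · simp [h, Finset.filter_ne']

/-- The complex entry with real part plus imaginary part equal to `d t`, subject to the reality
condition relating the entries at `t` and `2 * κ - t`. -/
def entryOfReal (κ : ℕ) (d : ℕ → ℝ) (t : ℕ) : ℂ :=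
  ((d t + (-1) ^ t * d (2 * κ - t)) / 2 : ℝ) +
    ((d t - (-1) ^ t * d (2 * κ - t)) / 2 : ℝ) * Complex.I

lemma entryOfReal_re_add_im (κ : ℕ) (d : ℕ → ℝ) (t : ℕ) :
    (entryOfReal κ d t).re + (entryOfReal κ d t).im = d t := by
  simp only [entryOfReal, Complex.add_re, Complex.add_im, Complex.ofReal_re, Complex.ofReal_im,
    Complex.re_ofReal_mul, Complex.im_ofReal_mul, Complex.I_re, Complex.I_im]
  ring

lemma neg_one_pow_two_mul_sub {R : Type*} [Ring R] {κ t : ℕ} (ht : t ≤ 2 * κ) :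
    (-1 : R) ^ (2 * κ - t) = (-1) ^ t := by
  rcases Nat.even_or_odd t with h | h
  · rw [h.neg_one_pow, Even.neg_one_pow]
    exact (Nat.even_sub ht).mpr (by simp [h])
  · rw [h.neg_one_pow, Odd.neg_one_pow]
    rw [← Nat.not_even_iff_odd] at h ⊢
    rw [Nat.even_sub ht]
    simp [h]

lemma entryOfReal_symm {κ t : ℕ} (d : ℕ → ℝ) (ht : t ≤ 2 * κ) :
    entryOfReal κ d (2 * κ - t) = (-1) ^ t * (starRingEnd ℂ) (entryOfReal κ d t) := by
  have hs : (-1 : ℂ) ^ t * (-1) ^ t = 1 := by rw [← mul_pow]; simp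
  simp only [entryOfReal, Nat.sub_sub_self ht, neg_one_pow_two_mul_sub ht, map_add, map_mul,
    Complex.conj_ofReal, Complex.conj_I]
  push_cast
  linear_combination (-(d (2 * κ - t) : ℂ) / 2 - (d (2 * κ - t) : ℂ) / 2 * Complex.I) * hs

/-- The independent real coordinates of a table. -/
def tableCoord (n κ : ℕ) :
    invariantTable n (2 * κ) →ₗ[ℝ] (freeColumns n κ × Fin (2 * κ + 1) → ℝ) where
  toFun γ x := (γ.1 (κ + n * x.1) x.2).re + (γ.1 (κ + n * x.1) x.2).im
  map_add' γ δ := by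
    funext x
    simp
    ring
  map_smul' c γ := by
    funext x
    simp
    ring

lemma tableCoord_injective (n κ : ℕ) : Function.Injective (tableCoord n κ) := by
  rw [← LinearMap.ker_eq_bot, eq_bot_iff]
  rintro ⟨γ, h1, h2, h3, h4⟩ hγ
  rw [Submodule.mem_bot]
  refine Subtype.ext (funext fun p => funext fun t => ?_)
  change γ p t = 0
  have hsum : ∀ j ∈ freeColumns n κ, ∀ t ≤ 2 * κ,
      (γ (κ + n * j) t).re + (γ (κ + n * j) t).im = 0 := fun j hj t ht =>
    congrFun hγ (⟨j, hj⟩, ⟨t, by omega⟩)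
  have hle : ∀ j ∈ freeColumns n κ, κ + n * j ≤ 2 * κ := fun j hj => by
    have h5 : j ≤ κ / n := by
      have := Finset.mem_range.mp (Finset.mem_filter.mp hj).1
      omega
    have h6 := Nat.mul_le_mul_left n h5
    have h7 := Nat.mul_div_le κ n
    omega
  have hfree : ∀ j ∈ freeColumns n κ, ∀ t ≤ 2 * κ, γ (κ + n * j) t = 0 := by
    intro j hj t ht
    have e1 := hsum j hj t ht
    have e2 := hsum j hj (2 * κ - t) (Nat.sub_le _ _)
    rw [h4 _ t (hle j hj) ht, pow_add, pow_mul, neg_one_sq, one_pow, one_mul] at e2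
    refine Complex.ext ?_ ?_ <;> rcases neg_one_pow_eq_or ℂ t with h | h <;>
      rw [h] at e2 <;> simp at e2 ⊢ <;> linarith
  have hright : ∀ p ≤ 2 * κ, κ ≤ p → ∀ t ≤ 2 * κ, γ p t = 0 := by
    intro p hp hκ t ht
    by_contra hne
    obtain ⟨j, rfl⟩ : ∃ j, p = κ + n * j := by
      obtain ⟨c, hc⟩ := h2 p t hne
      have hdvd : (n : ℤ) ∣ ((p - κ : ℕ) : ℤ) := by
        refine ⟨c, ?_⟩
        push_cast [hκ] at hc ⊢
        linarith
      obtain ⟨j, hj⟩ := Int.natCast_dvd_natCast.mp hdvd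
      exact ⟨j, by omega⟩
    by_cases hj : j ∈ freeColumns n κ
    · exact hne (hfree j hj t ht)
    · have hnj : n * j = 0 := by
        by_contra hnj
        have hn : 0 < n := Nat.pos_of_ne_zero (left_ne_zero_of_mul hnj)
        refine hj (Finset.mem_filter.mpr ⟨Finset.mem_range.mpr (Nat.lt_succ_of_le ?_),
          Or.inr (right_ne_zero_of_mul hnj)⟩)
        rw [Nat.le_div_iff_mul_le hn, mul_comm]
        omega
      by_cases hκe : Even κ
      · refine hne ?_
        rw [hnj, ← mul_zero n]
        exact hfree 0 (by simp [freeColumns, hκe]) t ht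
      · have := h3 κ t (by omega) ht
        rw [show 2 * κ - κ = κ by omega, (Nat.not_even_iff_odd.mp hκe).neg_one_pow] at this
        refine hne ?_
        rw [hnj, add_zero]
        have h2 : (2 : ℂ) * γ κ t = 0 := by linear_combination this
        simpa using h2
  by_cases hpt : p ≤ 2 * κ ∧ t ≤ 2 * κ
  · rcases le_total κ p with h | h
    · exact hright p hpt.1 h t hpt.2
    · have := h3 p t hpt.1 hpt.2
      rw [hright _ (Nat.sub_le _ _) (by omega) t hpt.2] at this
      simpa using this.symm
  · exact h1 p t hpt

lemma tableCoord_surjective {n : ℕ} (hn : 1 ≤ n) (κ : ℕ) :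
    Function.Surjective (tableCoord n κ) := by
  intro d
  let D : ℕ → ℕ → ℝ := fun j t =>
    if h : j ∈ freeColumns n κ ∧ t < 2 * κ + 1 then d (⟨j, h.1⟩, ⟨t, h.2⟩) else 0
  let s : ℕ → ℂ := fun p => if κ ≤ p then 1 else (-1) ^ p
  let γ : ℕ → ℕ → ℂ := fun p t =>
    if (p ≤ 2 * κ ∧ t ≤ 2 * κ) ∧ (n : ℤ) ∣ p - κ then
      s p * entryOfReal κ (D (((p : ℤ) - κ).natAbs / n)) t else 0
  have hs : ∀ p ≤ 2 * κ, p ≠ κ → s (2 * κ - p) = (-1) ^ p * s p := by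
    intro p hp hne
    simp only [s]
    rcases lt_or_gt_of_ne hne with h | h
    · rw [if_pos (by omega), if_neg (by omega), ← mul_pow]; simp
    · rw [if_neg (by omega), if_pos (by omega), neg_one_pow_two_mul_sub hp, mul_one]
  have hs_conj : ∀ p, (starRingEnd ℂ) (s p) = s p := by
    intro p
    simp only [s]
    split_ifs <;> simp
  have hγ : γ ∈ invariantTable n (2 * κ) := by
    refine ⟨fun p t h => if_neg fun hle => h hle.1, fun p t h => ?_, fun p t hp ht => ?_,
      fun p t hp ht => ?_⟩
    · have : (n : ℤ) ∣ p - κ := by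
        by_contra hdvd
        exact h (if_neg fun hc => hdvd hc.2)
      push_cast
      rw [← mul_sub]
      exact mul_dvd_mul_left 2 this
    · have hcast : ((2 * κ - p : ℕ) : ℤ) - κ = -((p : ℤ) - κ) := by
        push_cast [hp]; ring
      simp only [γ, hcast, Int.natAbs_neg, dvd_neg, hp, ht, Nat.sub_le, and_self, true_and]
      split_ifs with hdvd
      · rcases eq_or_ne p κ with rfl | hne
        · rw [show 2 * p - p = p by omega]
          by_cases hκ : Even p
          · rw [hκ.neg_one_pow, one_mul]
          · have h0 : ∀ t, D 0 t = 0 := fun t =>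
              dif_neg fun h => hκ (by simpa [freeColumns] using h.1)
            simp [entryOfReal, h0]
        · rw [hs p hp hne, mul_assoc]
      · simp
    · have hsgn : (-1 : ℂ) ^ (2 * κ + t) = (-1) ^ t := by simp [pow_add, pow_mul]
      simp only [γ, hp, ht, Nat.sub_le, and_self, true_and, hsgn]
      split_ifs with hdvd
      · rw [entryOfReal_symm _ ht, map_mul, hs_conj]; ring
      · simp
  refine ⟨⟨γ, hγ⟩, ?_⟩
  funext ⟨⟨j, hj⟩, ⟨t, ht⟩⟩
  change (γ (κ + n * j) t).re + (γ (κ + n * j) t).im = _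
  have hjn : n * j ≤ κ := by
    have := Finset.mem_range.mp (Finset.mem_filter.mp hj).1
    calc n * j ≤ n * (κ / n) := Nat.mul_le_mul_left n (by omega)
      _ ≤ κ := Nat.mul_div_le κ n
  have hsub : ((κ + n * j : ℕ) : ℤ) - κ = (n * j : ℕ) := by push_cast; ring
  have hval : γ (κ + n * j) t = entryOfReal κ (D j) t := by
    simp only [γ, hsub]
    rw [if_pos ⟨⟨by omega, by omega⟩, by simp⟩, Int.natAbs_natCast,
      Nat.mul_div_cancel_left j (by omega)]
    simp [s]
  rw [hval, entryOfReal_re_add_im]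
  exact dif_pos ⟨hj, ht⟩

lemma finrank_invariantTable {n : ℕ} (hn : 1 ≤ n) (κ : ℕ) :
    Module.finrank ℝ (invariantTable n (2 * κ)) = (2 * κ + 1) * (freeColumns n κ).card := by
  rw [(LinearEquiv.ofBijective (tableCoord n κ)
    ⟨tableCoord_injective n κ, tableCoord_surjective hn κ⟩).finrank_eq,
    Module.finrank_fintype_fun_eq_card]
  simp [mul_comm]

/-- the dimension of the space of degree-`k` homogeneous harmonic
polynomial functions invariant under the binary dihedral group `D*_n`,
matching Ikeda's multiplicity formulas. -/
theorem stmt_16 (n : ℕ) (hn : 1 ≤ n) (k : ℕ) :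
    (Odd k →
      Set.finrank ℝ {f : (Fin 4 → ℝ) → ℝ |
        IsHomogeneousPolyEval k f ∧ IsHarmonic f ∧
        f ∘ Rrot (Real.pi / n) (Real.pi / n) = f ∧ f ∘ Amap = f} = 0)
    ∧ (∀ κ : ℕ, k = 2 * κ →
      Set.finrank ℝ {f : (Fin 4 → ℝ) → ℝ |
        IsHomogeneousPolyEval k f ∧ IsHarmonic f ∧
        f ∘ Rrot (Real.pi / n) (Real.pi / n) = f ∧ f ∘ Amap = f}
      = if Even κ then (2 * κ + 1) * (κ / n + 1) else (2 * κ + 1) * (κ / n)) := by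
  refine ⟨fun hk => ?_, fun κ hκ => ?_⟩
  · rw [finrank_invariant_harmonic hn, invariantTable_eq_bot_of_odd n hk, finrank_bot]
  · subst hκ
    rw [finrank_invariant_harmonic hn, finrank_invariantTable hn, card_freeColumns, mul_ite]

end
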